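/- arXiv:2011.03004 — 4 statements merged into one kernel-verified Lean document; each statement's English description precedes it below -/
import Mathlib

section
/- Let n ≥ 1, let α = {a_1, a_2, ..., a_n} be a set of n elements, and let Γ1 : α → {0, 1, ..., n} be a partition of α. Fix an index i ∈ {1, ..., n} and set η = 0 if i = 1, and η = max{Γ1(a_j) : j < i} if i > 1. Suppose Γ1(a_i) = λ with λ > η + 1. Then there exists a partition Γ2 : α → {0, 1, ..., n} of α that is identical to Γ1 such that Γ2(a_u) = Γ1(a_u) for every index u < i and Γ2(a_i) = η + 1. -/
/-- `Γ1` and `Γ2` are identical: every part (fiber) of `Γ1` is a part of `Γ2`. -/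
def Identical {n : ℕ} (Γ1 Γ2 : Fin n → ℕ) : Prop :=
  ∀ j : ℕ, ∃ k : ℕ, {x : Fin n | Γ1 x = j} = {x : Fin n | Γ2 x = k}

/-- If a partition `Γ1` assigns to `a_i` a value `λ > η + 1`, where `η` is the maximum value
assigned to the earlier elements (`η = 0` when `i` is the first index), then there is an
identical partition `Γ2` agreeing with `Γ1` before `i` and with `Γ2(a_i) = η + 1`. -/
theorem statement_0 (n : ℕ) (hn : 1 ≤ n) (Γ1 : Fin n → ℕ)
    (hbound : ∀ x, Γ1 x ≤ n) (hpart : ∀ x, Γ1 x ≠ 0)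
    (i : Fin n) (η : ℕ)
    (hη : η = (Finset.univ.filter (fun j : Fin n => j < i)).sup Γ1)
    (hlam : η + 1 < Γ1 i) :
    ∃ Γ2 : Fin n → ℕ, (∀ x, Γ2 x ≤ n) ∧ (∀ x, Γ2 x ≠ 0) ∧ Identical Γ1 Γ2 ∧
      (∀ u : Fin n, u < i → Γ2 u = Γ1 u) ∧ Γ2 i = η + 1 := by
  have hle : ∀ u < i, Γ1 u ≤ η := fun u hu => by
    rw [hη]
    exact Finset.le_sup (f := Γ1) (by simpa using hu)
  have hi := hbound i
  refine ⟨fun x => Equiv.swap (η + 1) (Γ1 i) (Γ1 x), fun x => ?_, fun x => ?_, fun j => ?_,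
    fun u hu => ?_, Equiv.swap_apply_right _ _⟩
  · have hx := hbound x
    simp only [Equiv.swap_apply_def]
    split_ifs <;> omega
  · have hx := hpart x
    simp only [Equiv.swap_apply_def]
    split_ifs <;> omega
  · exact ⟨Equiv.swap (η + 1) (Γ1 i) j, by simp⟩
  · have hu' := hle u hu
    exact Equiv.swap_apply_of_ne_of_ne (by omega) (by omega)
end

section
/- Let α = {a_1, ..., a_n} be a set of n elements, δ < n a non-negative integer, and Γ1 : α → {0, 1, ..., n} a total mapping. Let β = {j ∈ {1, ..., n} : 0 < |{x ∈ α : Γ1(x) = j}| ≤ δ} and assume β is nonempty and |{x ∈ α : Γ1(x) = 0}| < Σ_{j ∈ β} (δ − |{x ∈ α : Γ1(x) = j}| + 1). Then every total mapping Γ2 : α → {0, 1, ..., n} satisfying Γ2(x) = Γ1(x) for all x with Γ1(x) > 0 is not a δ-partition of α. -/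
/-- The size of the part `j` of a mapping `Γ`, i.e. `|{x : Γ(x) = j}|`. -/
def fiberCard {α : Type*} [Fintype α] (Γ : α → ℕ) (j : ℕ) : ℕ :=
  (Finset.univ.filter (fun x => Γ x = j)).card

/-- `Γ` is a `δ`-partition: `Γ(x) ≠ 0` for all `x`, and every nonempty part has more
than `δ` elements. -/
def IsDeltaPartition {α : Type*} [Fintype α] (n δ : ℕ) (Γ : α → ℕ) : Prop :=
  (∀ x, Γ x ≠ 0) ∧ ∀ j ∈ Finset.Icc 1 n, fiberCard Γ j = 0 ∨ δ < fiberCard Γ j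

/-- If `Γ2` extends the positive part of `Γ1`, then each positive part of `Γ2` is the
corresponding part of `Γ1` together with elements left unassigned by `Γ1`. -/
lemma fiberCard_extension {α : Type*} [Fintype α] {Γ1 Γ2 : α → ℕ}
    (hext : ∀ x, 0 < Γ1 x → Γ2 x = Γ1 x) {j : ℕ} (hj : 0 < j) :
    fiberCard Γ2 j = fiberCard Γ1 j +
      ((Finset.univ.filter (fun x => Γ1 x = 0)).filter (fun x => Γ2 x = j)).card := by
  classical
  unfold fiberCard
  rw [← Finset.card_union_of_disjoint]
  · congr 1
    ext x
    have := hext x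
    simp only [Finset.mem_union, Finset.mem_filter, Finset.mem_univ, true_and]
    omega
  · rw [Finset.disjoint_left]
    intro x hx
    simp only [Finset.mem_filter, Finset.mem_univ, true_and] at hx ⊢
    omega

/-- If `β = {j ∈ {1,…,n} : 0 < |{x : Γ1(x) = j}| ≤ δ}` is nonempty and
`|{x : Γ1(x) = 0}| < Σ_{j ∈ β} (δ − |{x : Γ1(x) = j}| + 1)`, then no extension of the
positive part of `Γ1` is a `δ`-partition. -/
theorem statement_1 (n δ : ℕ) (hδ : δ < n) (Γ1 : Fin n → ℕ)
    (hbound : ∀ x, Γ1 x ≤ n)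
    (β : Finset ℕ)
    (hβ : β = (Finset.Icc 1 n).filter
      (fun j => 0 < fiberCard Γ1 j ∧ fiberCard Γ1 j ≤ δ))
    (hne : β.Nonempty)
    (hlt : fiberCard Γ1 0 < ∑ j ∈ β, (δ - fiberCard Γ1 j + 1)) :
    ∀ Γ2 : Fin n → ℕ, (∀ x, Γ2 x ≤ n) →
      (∀ x, 0 < Γ1 x → Γ2 x = Γ1 x) →
      ¬ IsDeltaPartition n δ Γ2 := by
  intro Γ2 _ hext ⟨_, hpart⟩
  refine hlt.not_ge ?_
  calc ∑ j ∈ β, (δ - fiberCard Γ1 j + 1)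
      ≤ ∑ j ∈ β,
          ((Finset.univ.filter (fun x => Γ1 x = 0)).filter (fun x => Γ2 x = j)).card := by
        refine Finset.sum_le_sum fun j hj => ?_
        rw [hβ, Finset.mem_filter] at hj
        obtain ⟨hjn, hpos, hle⟩ := hj
        have hsplit := fiberCard_extension hext (Finset.mem_Icc.mp hjn).1
        have hsize := hpart j hjn
        omega
    _ ≤ fiberCard Γ1 0 := by
        rw [← Finset.card_biUnion]
        · exact Finset.card_le_card
            (Finset.biUnion_subset.mpr fun j _ => Finset.filter_subset _ _)
        · intro i _ j _ hij
          refine Finset.disjoint_left.mpr ?_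
          intro x hxi hxj
          exact hij ((Finset.mem_filter.mp hxi).2.symm.trans (Finset.mem_filter.mp hxj).2)
end

section
/- Let α = {a_1, ..., a_n} be a set of n elements, δ < n a non-negative integer, and Γ1 : α → {0, 1, ..., n} a total mapping. Let β = {j ∈ {1, ..., n} : 0 < |{x ∈ α : Γ1(x) = j}| ≤ δ} and assume β is nonempty and |{x ∈ α : Γ1(x) = 0}| = Σ_{j ∈ β} (δ − |{x ∈ α : Γ1(x) = j}| + 1). Then for every total mapping Γ2 : α → {0, 1, ..., n} satisfying Γ2(x) = Γ1(x) for all x with Γ1(x) > 0: if there exists y ∈ α with Γ1(y) = 0 and Γ2(y) = k for some k ∉ β, then Γ2 is not a δ-partition of α. -/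
/-- If `Γ2` extends the positive part of `Γ1`, then the part `j` of `Γ2` is at most the part `j`
of `Γ1` together with the elements of the part `0` of `Γ1` sent to `j`. -/
theorem fiberCard_le_of_extends {α : Type*} [Fintype α] {Γ1 Γ2 : α → ℕ}
    (hext : ∀ x, 0 < Γ1 x → Γ2 x = Γ1 x) (j : ℕ) :
    fiberCard Γ2 j ≤ fiberCard Γ1 j +
      ((Finset.univ.filter (fun x => Γ1 x = 0)).filter (fun x => Γ2 x = j)).card := by
  classical
  refine (Finset.card_le_card fun x hx => ?_).trans (Finset.card_union_le _ _)
  simp only [Finset.mem_union, Finset.mem_filter, Finset.mem_univ, true_and] at hx ⊢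
  rcases Nat.eq_zero_or_pos (Γ1 x) with h | h
  · exact Or.inr ⟨h, hx⟩
  · exact Or.inl ((hext x h).symm.trans hx)

/-- If `β = {j ∈ {1,…,n} : 0 < |{x : Γ1(x) = j}| ≤ δ}` is nonempty and
`|{x : Γ1(x) = 0}| = Σ_{j ∈ β} (δ − |{x : Γ1(x) = j}| + 1)`, then any extension `Γ2`
of the positive part of `Γ1` mapping some `y` with `Γ1(y) = 0` to a value `k ∉ β`
is not a `δ`-partition. -/
theorem statement_2 (n δ : ℕ) (hδ : δ < n) (Γ1 : Fin n → ℕ)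
    (hbound : ∀ x, Γ1 x ≤ n)
    (β : Finset ℕ)
    (hβ : β = (Finset.Icc 1 n).filter
      (fun j => 0 < fiberCard Γ1 j ∧ fiberCard Γ1 j ≤ δ))
    (hne : β.Nonempty)
    (heq : fiberCard Γ1 0 = ∑ j ∈ β, (δ - fiberCard Γ1 j + 1)) :
    ∀ Γ2 : Fin n → ℕ, (∀ x, Γ2 x ≤ n) →
      (∀ x, 0 < Γ1 x → Γ2 x = Γ1 x) →
      (∃ y, Γ1 y = 0 ∧ Γ2 y ∉ β) →
      ¬ IsDeltaPartition n δ Γ2 := by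
  rintro Γ2 - hext ⟨y, hy0, hyβ⟩ ⟨-, hpart⟩
  set zeros := Finset.univ.filter (fun x => Γ1 x = 0) with hzeros
  have hsum : ∑ j ∈ β, (δ - fiberCard Γ1 j + 1) ≤
      ∑ j ∈ β, (zeros.filter (fun x => Γ2 x = j)).card := by
    refine Finset.sum_le_sum fun j hj => ?_
    rw [hβ, Finset.mem_filter, Finset.mem_Icc] at hj
    obtain ⟨⟨hj1, hjn⟩, hpos, hle⟩ := hj
    have hmono : fiberCard Γ1 j ≤ fiberCard Γ2 j := by
      refine Finset.card_le_card fun x hx => ?_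
      simp only [Finset.mem_filter, Finset.mem_univ, true_and] at hx ⊢
      exact (hext x (by omega)).trans hx
    have hcard := fiberCard_le_of_extends hext j
    rw [← hzeros] at hcard
    have := hpart j (Finset.mem_Icc.2 ⟨hj1, hjn⟩)
    omega
  have hfib : (zeros.filter (fun x => Γ2 x ∈ β)).card =
      ∑ j ∈ β, (zeros.filter (fun x => Γ2 x = j)).card := by
    rw [Finset.card_eq_sum_card_fiberwise (s := zeros.filter (fun x => Γ2 x ∈ β)) (f := Γ2) (t := β)
      fun x hx => (Finset.mem_filter.1 hx).2]
    refine Finset.sum_congr rfl fun j hj => ?_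
    congr 1
    ext x
    simp only [Finset.mem_filter]
    grind
  have hlt : (zeros.filter (fun x => Γ2 x ∈ β)).card < zeros.card :=
    Finset.card_lt_card (Finset.filter_ssubset.2 ⟨y, by simp [hzeros, hy0], hyβ⟩)
  have hzero : zeros.card = fiberCard Γ1 0 := rfl
  omega
end

section
/- Let α be a finite set with n = |α|, δ a non-negative integer, and Γ : α → {0, 1, ..., n} a total mapping. Let x₀ ∈ α with Γ(x₀) = 0 and let ρ be a positive integer with 0 < |{x ∈ α : Γ(x) = ρ}| ≤ δ. Define Γ' to agree with Γ everywhere except Γ'(x₀) = ρ. If |{x ∈ α : Γ(x) = 0}| > Σ_{j ∈ β(Γ)} (δ − |{x ∈ α : Γ(x) = j}| + 1), then |{x ∈ α : Γ'(x) = 0}| > Σ_{j ∈ β(Γ')} (δ − |{x ∈ α : Γ'(x) = j}| + 1). -/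
/-- `β(Γ) = {j ∈ {1,…,n} : 0 < |{x : Γ(x) = j}| ≤ δ}`. -/
def betaSet {α : Type*} [Fintype α] (n δ : ℕ) (Γ : α → ℕ) : Finset ℕ :=
  (Finset.Icc 1 n).filter (fun j => 0 < fiberCard Γ j ∧ fiberCard Γ j ≤ δ)

theorem fiberCard_update_self {α : Type*} [Fintype α] [DecidableEq α] (Γ : α → ℕ) {x₀ : α}
    {ρ : ℕ} (h : Γ x₀ ≠ ρ) :
    fiberCard (Function.update Γ x₀ ρ) ρ = fiberCard Γ ρ + 1 := by
  unfold fiberCard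
  rw [← Finset.card_insert_of_notMem (a := x₀) (by simp [h])]
  congr 1
  ext x
  by_cases hx : x = x₀ <;> simp [hx, Function.update_apply]

theorem fiberCard_update_apply_add_one {α : Type*} [Fintype α] [DecidableEq α] (Γ : α → ℕ)
    {x₀ : α} {ρ : ℕ} (h : Γ x₀ ≠ ρ) :
    fiberCard (Function.update Γ x₀ ρ) (Γ x₀) + 1 = fiberCard Γ (Γ x₀) := by
  unfold fiberCard
  rw [← Finset.card_insert_of_notMem (a := x₀) (by simp [h.symm])]
  congr 1
  ext x
  by_cases hx : x = x₀ <;> simp [hx, Function.update_apply]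

theorem fiberCard_update_of_ne {α : Type*} [Fintype α] [DecidableEq α] (Γ : α → ℕ)
    {x₀ : α} {ρ j : ℕ} (h : j ≠ ρ) (h₀ : j ≠ Γ x₀) :
    fiberCard (Function.update Γ x₀ ρ) j = fiberCard Γ j := by
  unfold fiberCard
  congr 1
  ext x
  by_cases hx : x = x₀ <;> simp [hx, Function.update_apply, h.symm, h₀.symm]

/-- Mapping an unassigned element `x₀` to a value `ρ` whose part is nonempty and has at
most `δ` elements preserves the strict inequality
`|{x : Γ(x) = 0}| > Σ_{j ∈ β(Γ)} (δ − |{x : Γ(x) = j}| + 1)`. -/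
theorem statement_5 (α : Type*) [Fintype α] [DecidableEq α]
    (n δ : ℕ) (hn : n = Fintype.card α)
    (Γ : α → ℕ) (hbound : ∀ x, Γ x ≤ n)
    (x₀ : α) (hx₀ : Γ x₀ = 0)
    (ρ : ℕ) (hρ : 0 < ρ) (hρ1 : 0 < fiberCard Γ ρ) (hρ2 : fiberCard Γ ρ ≤ δ)
    (Γ' : α → ℕ) (hΓ' : Γ' = Function.update Γ x₀ ρ)
    (hlt : ∑ j ∈ betaSet n δ Γ, (δ - fiberCard Γ j + 1) < fiberCard Γ 0) :
    ∑ j ∈ betaSet n δ Γ', (δ - fiberCard Γ' j + 1) < fiberCard Γ' 0 := by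
  subst hΓ'
  have hne : Γ x₀ ≠ ρ := by omega
  have hself := fiberCard_update_self Γ hne
  have hzero := fiberCard_update_apply_add_one Γ hne
  rw [hx₀] at hzero
  have hmem : ρ ∈ Finset.Icc 1 n := by
    obtain ⟨x, hx⟩ := Finset.card_pos.mp hρ1
    have hxρ : Γ x = ρ := by simpa using hx
    have := hbound x
    rw [Finset.mem_Icc]
    omega
  have hrest : ∀ j ∈ (Finset.Icc 1 n).erase ρ,
      fiberCard (Function.update Γ x₀ ρ) j = fiberCard Γ j := by
    intro j hj
    rw [Finset.mem_erase, Finset.mem_Icc] at hj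
    exact fiberCard_update_of_ne Γ hj.1 (by omega)
  unfold betaSet at hlt ⊢
  rw [Finset.sum_filter, ← Finset.add_sum_erase _ _ hmem] at hlt ⊢
  rw [Finset.sum_congr rfl fun j hj => by rw [hrest j hj], hself]
  rw [if_pos ⟨hρ1, hρ2⟩] at hlt
  split_ifs <;> omega
end
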